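/- Let I = (0,a), 0 < a ≤ ∞, φ an Orlicz function and w a positive decreasing weight function on I with W(t) = ∫₀ᵗ w < ∞ for all t ∈ I. Then the fundamental function of the space 𝓜_{φ,w}, defined by F_𝓜(t) = ‖χ_(0,t)‖_𝓜 where ‖f‖_𝓜 = inf{ ε > 0 : P(f/ε) ≤ 1 } and P(f) = inf { ∫_I φ(|f|/v) v : v ≥ 0, v ≺ w }, is given by F_𝓜(t) = t / ( W(t) · φ⁻¹(1/W(t)) ) for all t ∈ I. Moreover, for every c > 0 and t ∈ I one has P((1/c) χ_(0,t)) = W(t) φ( t / (c W(t)) ). -/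

import Mathlib

open MeasureTheory Set Filter Topology ENNReal

noncomputable section

namespace OrliczRearrangement

/-- An Orlicz function: convex on `[0,∞)`, strictly increasing on `[0,∞)` and vanishing at `0`. -/
def IsOrliczFn (φ : ℝ → ℝ) : Prop :=
  ConvexOn ℝ (Set.Ici 0) φ ∧ StrictMonoOn φ (Set.Ici 0) ∧ φ 0 = 0

/-- An `N`-function: an Orlicz function with `φ(t)/t → 0` as `t → 0⁺` and `φ(t)/t → ∞`
as `t → ∞`. -/
def IsNFn (φ : ℝ → ℝ) : Prop :=
  IsOrliczFn φ ∧ Filter.Tendsto (fun t => φ t / t) (nhdsWithin 0 (Set.Ioi 0)) (nhds 0) ∧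
    Filter.Tendsto (fun t => φ t / t) Filter.atTop Filter.atTop

/-- The complementary (conjugate) function `φ*(t) = sup_{s>0} (st - φ(s))`. -/
def conjFn (φ : ℝ → ℝ) (t : ℝ) : ℝ := sSup ((fun s => s * t - φ s) '' Set.Ioi 0)

/-- The interval `I = (0,a)`, `0 < a ≤ ∞`, as a subset of `ℝ`. -/
def Ioa' (a : ℝ≥0∞) : Set ℝ := {t : ℝ | 0 < t ∧ ENNReal.ofReal t < a}

/-- Distribution function `d_f(s) = |{t ∈ (0,a) : |f(t)| > s}|`. -/
def distr (a : ℝ≥0∞) (f : ℝ → ℝ) (s : ℝ) : ℝ≥0∞ := volume {t ∈ Ioa' a | s < |f t|}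

/-- Decreasing rearrangement `f*(t) = inf{s ≥ 0 : d_f(s) ≤ t}` of `f` on `(0,a)`,
with value `∞` when no such `s` exists. -/
def decRe (a : ℝ≥0∞) (f : ℝ → ℝ) (t : ℝ) : ℝ≥0∞ :=
  sInf (ENNReal.ofReal '' {s : ℝ | 0 ≤ s ∧ distr a f s ≤ ENNReal.ofReal t})

/-- Distribution of a sequence: `d_x(s) = |{k : |x(k)| > s}|`. -/
def sdistr (x : ℕ → ℝ) (s : ℝ) : ℕ∞ := {k : ℕ | s < |x k|}.encard

/-- Decreasing rearrangement of a sequence (`0`-indexed):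
`x*(n) = inf{s > 0 : d_x(s) ≤ n}`, with value `∞` when no such `s` exists. -/
def sdecRe (x : ℕ → ℝ) (n : ℕ) : ℝ≥0∞ :=
  sInf (ENNReal.ofReal '' {s : ℝ | 0 < s ∧ sdistr x s ≤ (n : ℕ∞)})

/-- The extended-real quantity `φ(c/v)·v`, with the convention that for `v = 0` it equals
`0` if `c = 0` and `∞` if `c ≠ 0`. -/
def oterm (φ : ℝ → ℝ) (c v : ℝ) : ℝ≥0∞ :=
  if v = 0 then (if c = 0 then 0 else ∞) else ENNReal.ofReal (φ (c / v) * v)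

/-- The quantity `φ(c/v)·v` for an extended-real numerator `c`; it equals `∞` when
`c = ∞`. -/
def otermE (φ : ℝ → ℝ) (c : ℝ≥0∞) (v : ℝ) : ℝ≥0∞ :=
  if c = ∞ then ∞ else oterm φ c.toReal v

/-- The modular `M(f) = ∫_I φ(f*/w)·w`. -/
def Mmod (a : ℝ≥0∞) (φ w f : ℝ → ℝ) : ℝ≥0∞ :=
  ∫⁻ t in Ioa' a, otermE φ (decRe a f t) (w t)

/-- The functional `‖f‖_M = inf{ε > 0 : M(f/ε) ≤ 1}` (equal to `∞` if no such `ε`). -/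
def Mnorm (a : ℝ≥0∞) (φ w f : ℝ → ℝ) : ℝ≥0∞ :=
  ⨅ ε ∈ {ε : ℝ | 0 < ε ∧ Mmod a φ w (fun t => f t / ε) ≤ 1}, ENNReal.ofReal ε

/-- The class `M_{φ,w}` of measurable `f` with `M(λf) < ∞` for some `λ > 0`. -/
def Mclass (a : ℝ≥0∞) (φ w : ℝ → ℝ) : Set (ℝ → ℝ) :=
  {f | Measurable f ∧ ∃ c > 0, Mmod a φ w (fun t => c * f t) < ∞}

/-- Submajorization `v ≺ w` on `(0,a)`: `∫₀ᵗ v* ≤ ∫₀ᵗ w*` for all `t ∈ (0,a)`. -/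
def Submaj (a : ℝ≥0∞) (v w : ℝ → ℝ) : Prop :=
  ∀ t ∈ Ioa' a, ∫⁻ s in Set.Ioo 0 t, decRe a v s ≤ ∫⁻ s in Set.Ioo 0 t, decRe a w s

/-- The modular `P`, for (decreasing-rearrangement-like) `[0,∞]`-valued data `F`:
`P(F) = inf{∫_I φ(F/v)·v : v ≥ 0, v ≺ w}`. -/
def PmodE (a : ℝ≥0∞) (φ w : ℝ → ℝ) (F : ℝ → ℝ≥0∞) : ℝ≥0∞ :=
  ⨅ v ∈ {v : ℝ → ℝ | Measurable v ∧ (∀ t, 0 ≤ v t) ∧ Submaj a v w},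
    ∫⁻ t in Ioa' a, otermE φ (F t) (v t)

/-- The modular `P(f) = inf{∫_I φ(|f|/v)·v : v ≥ 0, v ≺ w}`. -/
def Pmod (a : ℝ≥0∞) (φ w f : ℝ → ℝ) : ℝ≥0∞ :=
  PmodE a φ w fun t => ENNReal.ofReal |f t|

/-- The norm of `𝓜_{φ,w}` for `[0,∞]`-valued data. -/
def PnormE (a : ℝ≥0∞) (φ w : ℝ → ℝ) (F : ℝ → ℝ≥0∞) : ℝ≥0∞ :=
  ⨅ ε ∈ {ε : ℝ | 0 < ε ∧ PmodE a φ w (fun t => F t / ENNReal.ofReal ε) ≤ 1},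
    ENNReal.ofReal ε

/-- The norm `‖f‖_𝓜 = inf{ε > 0 : P(f/ε) ≤ 1}`. -/
def Pnorm (a : ℝ≥0∞) (φ w f : ℝ → ℝ) : ℝ≥0∞ :=
  PnormE a φ w fun t => ENNReal.ofReal |f t|

/-- The space `𝓜_{φ,w}` of measurable `f` with `P(λf) < ∞` for some `λ > 0`. -/
def Pclass (a : ℝ≥0∞) (φ w : ℝ → ℝ) : Set (ℝ → ℝ) :=
  {f | Measurable f ∧ ∃ c > 0, Pmod a φ w (fun t => c * f t) < ∞}

/-- Sequence submajorization `v ≺ w`. -/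
def sSubmaj (v w : ℕ → ℝ) : Prop :=
  ∀ m : ℕ, ∑ n ∈ Finset.range m, sdecRe v n ≤ ∑ n ∈ Finset.range m, sdecRe w n

/-- Sequence modular `p` for `[0,∞]`-valued data. -/
def spmodE (φ : ℝ → ℝ) (w : ℕ → ℝ) (X : ℕ → ℝ≥0∞) : ℝ≥0∞ :=
  ⨅ v ∈ {v : ℕ → ℝ | (∀ n, 0 ≤ v n) ∧ sSubmaj v w}, ∑' n, otermE φ (X n) (v n)

/-- Sequence modular `p(x) = inf{∑ φ(|x(n)|/v(n))·v(n) : v ≥ 0, v ≺ w}`. -/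
def spmod (φ : ℝ → ℝ) (w x : ℕ → ℝ) : ℝ≥0∞ :=
  spmodE φ w fun n => ENNReal.ofReal |x n|

/-- Sequence norm for `[0,∞]`-valued data. -/
def spnormE (φ : ℝ → ℝ) (w : ℕ → ℝ) (X : ℕ → ℝ≥0∞) : ℝ≥0∞ :=
  ⨅ ε ∈ {ε : ℝ | 0 < ε ∧ spmodE φ w (fun n => X n / ENNReal.ofReal ε) ≤ 1},
    ENNReal.ofReal ε

/-- Sequence norm `‖x‖_𝔪 = inf{ε > 0 : p(x/ε) ≤ 1}`. -/
def spnorm (φ : ℝ → ℝ) (w x : ℕ → ℝ) : ℝ≥0∞ :=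
  spnormE φ w fun n => ENNReal.ofReal |x n|

/-- Dilation operator `D₂f(t) = f(t/2)`, where `f` is extended by `0` outside `(0,a)`. -/
def D2 (a : ℝ≥0∞) (f : ℝ → ℝ) : ℝ → ℝ := fun t => (Ioa' a).indicator f (t / 2)

/-- A measure preserving transformation from `S` onto `S`. -/
def MeasPresOn (σ : ℝ → ℝ) (S : Set ℝ) : Prop :=
  Set.MapsTo σ S S ∧ Set.SurjOn σ S S ∧ Measurable σ ∧
    ∀ A : Set ℝ, A ⊆ S → MeasurableSet A → volume (S ∩ σ ⁻¹' A) = volume A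

/-- Luxemburg norm of the weighted Orlicz space `L_φ(w)` on `(0,a)`. -/
def luxNorm (a : ℝ≥0∞) (φ w g : ℝ → ℝ) : ℝ≥0∞ :=
  ⨅ ε ∈ {ε : ℝ | 0 < ε ∧
      ∫⁻ t in Ioa' a, ENNReal.ofReal (φ (|g t| / ε) * w t) ≤ 1}, ENNReal.ofReal ε

/-- The Orlicz norm of `f` in `Λ_{φ*,w}`, defined by duality with the unit ball of
`L_φ(w)`: `‖f‖⁰ = sup{∫_I f° g w : g ≥ 0, ‖g‖_{L_φ(w)} ≤ 1}`. -/
def lamOnorm (a : ℝ≥0∞) (φ w f : ℝ → ℝ) : ℝ≥0∞ :=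
  ⨆ g ∈ {g : ℝ → ℝ | Measurable g ∧ (∀ t, 0 ≤ g t) ∧ luxNorm a φ w g ≤ 1},
    ∫⁻ t in Ioa' a, decRe a f t * ENNReal.ofReal (g t * w t)

/-- The Orlicz–Lorentz class `Λ_{φs,w}`: measurable `g` whose (finite) decreasing
rearrangement satisfies `∫_I φs(c·g°)·w < ∞` for some `c > 0`. -/
def LamClass (a : ℝ≥0∞) (φs w : ℝ → ℝ) : Set (ℝ → ℝ) :=
  {g | Measurable g ∧ (∀ t ∈ Ioa' a, decRe a g t < ∞) ∧
    ∃ c > 0, ∫⁻ t in Ioa' a, ENNReal.ofReal (φs (c * (decRe a g t).toReal) * w t) < ∞}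

/-- The (generalized right-continuous) inverse `φ⁻¹(y) = inf{s ≥ 0 : φ(s) ≥ y}`. -/
def phiInv (φ : ℝ → ℝ) (y : ℝ) : ℝ := sInf {s : ℝ | 0 ≤ s ∧ y ≤ φ s}

lemma Ioo_subset_Ioa' {a : ℝ≥0∞} {t : ℝ} (ht : t ∈ Ioa' a) : Set.Ioo 0 t ⊆ Ioa' a :=
  fun _ hs => ⟨hs.1, (ENNReal.ofReal_le_ofReal hs.2.le).trans_lt ht.2⟩

lemma decRe_le {a : ℝ≥0∞} {f : ℝ → ℝ} {t s : ℝ} (hs : 0 ≤ s)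
    (h : distr a f s ≤ ENNReal.ofReal t) : decRe a f t ≤ ENNReal.ofReal s :=
  sInf_le ⟨s, ⟨hs, h⟩, rfl⟩

lemma distr_antitone (a : ℝ≥0∞) (f : ℝ → ℝ) : Antitone (distr a f) :=
  fun _ _ h => measure_mono fun _ hx => ⟨hx.1, h.trans_lt hx.2⟩

/-- The part of the distribution function lying above `t` is controlled by the rearrangement
at `t`. -/
lemma volume_distr_le_decRe (a : ℝ≥0∞) (f : ℝ → ℝ) (t : ℝ) :
    volume.restrict (Set.Ioi 0) {r : ℝ | ENNReal.ofReal t < distr a f r} ≤ decRe a f t := by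
  refine le_sInf ?_
  rintro _ ⟨s, ⟨hs, hst⟩, rfl⟩
  rw [Measure.restrict_apply' measurableSet_Ioi]
  calc volume ({r : ℝ | ENNReal.ofReal t < distr a f r} ∩ Set.Ioi 0)
      ≤ volume (Set.Ioo 0 s) := by
        refine measure_mono fun r hr => ⟨hr.2, ?_⟩
        by_contra! h
        exact absurd hr.1 (not_lt.2 ((distr_antitone a f h).trans hst))
    _ = ENNReal.ofReal s := by simp

/-- A Hardy–Littlewood inequality: `∫₀ᵗ |f| ≤ ∫₀ᵗ f*`. -/
lemma lintegral_le_lintegral_decRe {a : ℝ≥0∞} {f : ℝ → ℝ} (hf : Measurable f) {t : ℝ}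
    (ht : t ∈ Ioa' a) :
    ∫⁻ s in Set.Ioo 0 t, ENNReal.ofReal |f s| ≤ ∫⁻ s in Set.Ioo 0 t, decRe a f s := by
  have hS : MeasurableSet {p : ℝ × ℝ | ENNReal.ofReal p.1 < distr a f p.2} :=
    measurableSet_lt (ENNReal.measurable_ofReal.comp measurable_fst)
      ((distr_antitone a f).measurable.comp measurable_snd)
  rw [lintegral_eq_lintegral_meas_lt _ (ae_of_all _ fun s => abs_nonneg (f s)) (by fun_prop)]
  calc ∫⁻ r in Set.Ioi 0, volume.restrict (Set.Ioo 0 t) {s | r < |f s|}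
      ≤ ∫⁻ r in Set.Ioi 0, volume.restrict (Set.Ioo 0 t)
          {s | ENNReal.ofReal s < distr a f r} := by
        refine lintegral_mono fun r => ?_
        simp only [Measure.restrict_apply' measurableSet_Ioo]
        have hfin : min (ENNReal.ofReal t) (distr a f r) ≠ ∞ :=
          ((min_le_left _ _).trans_lt ENNReal.ofReal_lt_top).ne
        calc volume ({s | r < |f s|} ∩ Set.Ioo 0 t)
            ≤ min (ENNReal.ofReal t) (distr a f r) := by
              refine le_min ((measure_mono Set.inter_subset_right).trans (by simp)) ?_
              exact measure_mono fun s hs => ⟨Ioo_subset_Ioa' ht hs.2, hs.1⟩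
          _ = volume (Set.Ioo 0 (min (ENNReal.ofReal t) (distr a f r)).toReal) := by
              simp [ENNReal.ofReal_toReal hfin]
          _ ≤ _ := by
              refine measure_mono fun s hs => ?_
              have h := (ENNReal.ofReal_lt_iff_lt_toReal hs.1.le hfin).2 hs.2
              have h' := lt_min_iff.1 h
              exact ⟨h'.2, hs.1, (ENNReal.ofReal_lt_ofReal_iff ht.1).1 h'.1⟩
    _ = ∫⁻ s in Set.Ioo 0 t, volume.restrict (Set.Ioi 0)
          {r | ENNReal.ofReal s < distr a f r} :=
        (Measure.prod_apply_symm (μ := volume.restrict (Set.Ioo 0 t))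
          (ν := volume.restrict (Set.Ioi 0)) hS).symm.trans (Measure.prod_apply hS)
    _ ≤ _ := lintegral_mono fun s => volume_distr_le_decRe a f s

lemma decRe_le_of_antitone {a : ℝ≥0∞} {w : ℝ → ℝ} (hw_pos : ∀ t ∈ Ioa' a, 0 < w t)
    (hw_dec : ∀ s ∈ Ioa' a, ∀ t ∈ Ioa' a, s ≤ t → w t ≤ w s) {s : ℝ} (hs : s ∈ Ioa' a) :
    decRe a w s ≤ ENNReal.ofReal (w s) := by
  refine decRe_le (hw_pos s hs).le ?_
  calc distr a w (w s) ≤ volume (Set.Ioo 0 s) := by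
        refine measure_mono fun r hr => ⟨hr.1.1, ?_⟩
        by_contra! h
        have h1 := hr.2
        rw [abs_of_pos (hw_pos r hr.1)] at h1
        exact absurd h1 (not_lt.2 (hw_dec s hs r hr.1 h))
    _ = ENNReal.ofReal s := by simp

lemma mul_le_lintegral_of_antitone {a : ℝ≥0∞} {w : ℝ → ℝ}
    (hw_dec : ∀ s ∈ Ioa' a, ∀ t ∈ Ioa' a, s ≤ t → w t ≤ w s) {t : ℝ} (ht : t ∈ Ioa' a) :
    ENNReal.ofReal (w t) * ENNReal.ofReal t ≤ ∫⁻ s in Set.Ioo 0 t, ENNReal.ofReal (w s) := by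
  calc ENNReal.ofReal (w t) * ENNReal.ofReal t
      = ∫⁻ _ in Set.Ioo 0 t, ENNReal.ofReal (w t) := by simp
    _ ≤ _ := setLIntegral_mono' measurableSet_Ioo fun s hs =>
        ENNReal.ofReal_le_ofReal (hw_dec s (Ioo_subset_Ioa' ht hs) t ht hs.2.le)

/-- Averages of a decreasing function decrease: `r W(t) ≤ t W(r)` for `r ≤ t`. -/
lemma mul_lintegral_le_of_antitone {a : ℝ≥0∞} {w : ℝ → ℝ}
    (hw_dec : ∀ s ∈ Ioa' a, ∀ t ∈ Ioa' a, s ≤ t → w t ≤ w s) {r t : ℝ} (hr : 0 < r)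
    (hrt : r ≤ t) (ht : t ∈ Ioa' a) :
    ENNReal.ofReal r * ∫⁻ s in Set.Ioo 0 t, ENNReal.ofReal (w s) ≤
      ENNReal.ofReal t * ∫⁻ s in Set.Ioo 0 r, ENNReal.ofReal (w s) := by
  have hrI : r ∈ Ioa' a := ⟨hr, (ENNReal.ofReal_le_ofReal hrt).trans_lt ht.2⟩
  have hsub : Set.Ioo 0 t ⊆ Set.Ioo 0 r ∪ Set.Ico r t := fun s hs => by
    rcases lt_or_ge s r with h | h
    · exact Or.inl ⟨hs.1, h⟩
    · exact Or.inr ⟨h, hs.2⟩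
  have htail : ∫⁻ s in Set.Ico r t, ENNReal.ofReal (w s) ≤
      ENNReal.ofReal (w r) * ENNReal.ofReal (t - r) := by
    calc ∫⁻ s in Set.Ico r t, ENNReal.ofReal (w s)
        ≤ ∫⁻ _ in Set.Ico r t, ENNReal.ofReal (w r) :=
          setLIntegral_mono' measurableSet_Ico fun s hs =>
            ENNReal.ofReal_le_ofReal (hw_dec r hrI s
              ⟨hr.trans_le hs.1, (ENNReal.ofReal_le_ofReal hs.2.le).trans_lt ht.2⟩ hs.1)
      _ = _ := by simp
  set A := ∫⁻ s in Set.Ioo 0 r, ENNReal.ofReal (w s)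
  calc ENNReal.ofReal r * ∫⁻ s in Set.Ioo 0 t, ENNReal.ofReal (w s)
      ≤ ENNReal.ofReal r * (A + ENNReal.ofReal (w r) * ENNReal.ofReal (t - r)) := by
        gcongr
        exact (lintegral_mono_set hsub).trans ((lintegral_union_le _ _ _).trans
          (add_le_add le_rfl htail))
    _ = ENNReal.ofReal r * A +
          (ENNReal.ofReal (w r) * ENNReal.ofReal r) * ENNReal.ofReal (t - r) := by ring
    _ ≤ ENNReal.ofReal r * A + A * ENNReal.ofReal (t - r) := by
        gcongr
        exact mul_le_lintegral_of_antitone hw_dec hrI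
    _ = (ENNReal.ofReal r + ENNReal.ofReal (t - r)) * A := by ring
    _ = ENNReal.ofReal t * A := by
        rw [← ENNReal.ofReal_add hr.le (sub_nonneg.2 hrt), add_sub_cancel]

/-- The average of a decreasing weight over `(0,t)` is submajorized by the weight. -/
lemma submaj_average {a : ℝ≥0∞} {w : ℝ → ℝ} (hw_meas : Measurable w)
    (hw_dec : ∀ s ∈ Ioa' a, ∀ t ∈ Ioa' a, s ≤ t → w t ≤ w s) {t : ℝ} (ht : t ∈ Ioa' a)
    (hWt : ∫⁻ s in Set.Ioo 0 t, ENNReal.ofReal (w s) ≠ ∞) :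
    Submaj a (Set.indicator (Set.Ioo 0 t)
      fun _ => (∫⁻ s in Set.Ioo 0 t, ENNReal.ofReal (w s)).toReal / t) w := by
  set A := ∫⁻ s in Set.Ioo 0 t, ENNReal.ofReal (w s) with hA
  set v : ℝ → ℝ := Set.indicator (Set.Ioo 0 t) fun _ => A.toReal / t with hv
  have hc : 0 ≤ A.toReal / t := div_nonneg ENNReal.toReal_nonneg ht.1.le
  have hle : ∀ s, decRe a v s ≤ ENNReal.ofReal (A.toReal / t) := fun s => by
    refine decRe_le hc ?_
    have : {x ∈ Ioa' a | A.toReal / t < |v x|} = ∅ := by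
      refine Set.eq_empty_of_forall_notMem fun x hx => absurd hx.2 (not_lt.2 ?_)
      by_cases h : x ∈ Set.Ioo 0 t
      · simp [hv, h.1, h.2, abs_of_nonneg hc]
      · simp [hv, Set.indicator_of_notMem h, hc]
    simp [distr, this]
  have hzero : ∀ s, t ≤ s → decRe a v s ≤ 0 := fun s hs => by
    rw [← ENNReal.ofReal_zero]
    refine decRe_le le_rfl ?_
    calc distr a v 0 ≤ volume (Set.Ioo 0 t) := by
          refine measure_mono fun x hx => ?_
          by_contra h
          have h2 := hx.2
          simp [hv, Set.indicator_of_notMem h] at h2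
      _ = ENNReal.ofReal t := by simp
      _ ≤ _ := ENNReal.ofReal_le_ofReal hs
  intro r hr
  have hm : 0 < min r t := lt_min hr.1 ht.1
  calc ∫⁻ s in Set.Ioo 0 r, decRe a v s
      ≤ ∫⁻ s in Set.Ioo 0 r, (Set.Ioo 0 t).indicator
          (fun _ => ENNReal.ofReal (A.toReal / t)) s := by
        refine setLIntegral_mono' measurableSet_Ioo fun s hs => ?_
        by_cases h : s < t
        · rw [Set.indicator_of_mem (show s ∈ Set.Ioo 0 t from ⟨hs.1, h⟩)]
          exact hle s
        · exact (hzero s (not_lt.1 h)).trans zero_le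
    _ = ENNReal.ofReal (A.toReal / t) * ENNReal.ofReal (min r t) := by
        rw [lintegral_indicator_const measurableSet_Ioo,
          Measure.restrict_apply measurableSet_Ioo, Set.Ioo_inter_Ioo, Real.volume_Ioo]
        simp [min_comm]
    _ = (ENNReal.ofReal (min r t) * A) / ENNReal.ofReal t := by
        rw [ENNReal.ofReal_div_of_pos ht.1, ENNReal.ofReal_toReal hWt, mul_comm, mul_div_assoc]
    _ ≤ ∫⁻ s in Set.Ioo 0 (min r t), ENNReal.ofReal (w s) := by
        refine ENNReal.div_le_of_le_mul ?_
        rw [mul_comm (lintegral _ _)]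
        exact mul_lintegral_le_of_antitone hw_dec hm (min_le_right _ _) ht
    _ ≤ ∫⁻ s in Set.Ioo 0 r, ENNReal.ofReal (w s) :=
        lintegral_mono_set (Set.Ioo_subset_Ioo_right (min_le_left _ _))
    _ ≤ ∫⁻ s in Set.Ioo 0 r, ENNReal.ofReal |w s| := by
        gcongr
        exact le_abs_self _
    _ ≤ _ := lintegral_le_lintegral_decRe hw_meas hr

/-- Supporting lines of convex functions at interior points of the half-line. -/
lemma exists_support_line {φ : ℝ → ℝ} (hφ : ConvexOn ℝ (Set.Ici 0) φ) {x₀ : ℝ} (hx₀ : 0 < x₀) :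
    ∃ m, ∀ x, 0 ≤ x → φ x₀ + m * (x - x₀) ≤ φ x := by
  have hint : x₀ ∈ interior (Set.Ici (0 : ℝ)) := by simpa using hx₀
  refine ⟨sInf (slope φ x₀ '' {y ∈ Set.Ici 0 | x₀ < y}), fun x hx => ?_⟩
  rcases lt_trichotomy x x₀ with h | rfl | h
  · have : slope φ x₀ x ≤ sInf (slope φ x₀ '' {y ∈ Set.Ici 0 | x₀ < y}) := by
      refine le_csInf ⟨_, x₀ + 1, ⟨by simp; linarith, by simp⟩, rfl⟩ ?_
      rintro _ ⟨y, hy, rfl⟩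
      exact hφ.slope_mono (interior_subset hint) ⟨hx, h.ne⟩ ⟨hy.1, hy.2.ne'⟩ (h.trans hy.2).le
    rw [slope_def_field, div_le_iff_of_neg (by linarith)] at this
    linarith
  · simp
  · have : sInf (slope φ x₀ '' {y ∈ Set.Ici 0 | x₀ < y}) ≤ slope φ x₀ x :=
      csInf_le (bddBelow_slope_lt_of_mem_interior hφ hint) ⟨x, ⟨hx, h⟩, rfl⟩
    rw [slope_def_field, le_div_iff₀ (by linarith)] at this
    linarith

/-- Jensen's inequality for the perspective `v ↦ φ(b/v) v` on `(0,t)`. -/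
lemma jensen_oterm {φ : ℝ → ℝ} (hφ : IsOrliczFn φ) {v : ℝ → ℝ} (hv : Measurable v)
    (hv0 : ∀ s, 0 ≤ v s) {b t A : ℝ} (hb : 0 < b) (ht : 0 < t) (hA : 0 < A)
    (hvA : ∫⁻ s in Set.Ioo 0 t, ENNReal.ofReal (v s) ≤ ENNReal.ofReal A) :
    ENNReal.ofReal (A * φ (t * b / A)) ≤ ∫⁻ s in Set.Ioo 0 t, oterm φ b (v s) := by
  set x₀ := t * b / A with hx₀
  have hx₀pos : 0 < x₀ := by positivity
  obtain ⟨m, hm⟩ := exists_support_line hφ.1 hx₀pos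
  have hk : 0 ≤ m * x₀ - φ x₀ := by
    have := hm 0 le_rfl
    rw [hφ.2.2] at this
    linarith
  set k := m * x₀ - φ x₀
  have hpt : ∀ s, ENNReal.ofReal (m * b) ≤
      oterm φ b (v s) + ENNReal.ofReal k * ENNReal.ofReal (v s) := fun s => by
    rcases (hv0 s).eq_or_lt with h | h
    · simp [oterm, ← h, hb.ne']
    · rw [oterm, if_neg h.ne', ← ENNReal.ofReal_mul hk]
      refine (ENNReal.ofReal_le_ofReal ?_).trans ENNReal.ofReal_add_le
      have h1 := mul_le_mul_of_nonneg_right (hm (b / v s) (by positivity)) h.le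
      have h2 : m * (b / v s) * v s = m * b := by field_simp
      calc m * b = (φ x₀ + m * (b / v s - x₀)) * v s + k * v s := by rw [← h2]; simp only [k]; ring
        _ ≤ _ := by linarith
  have hkA : ENNReal.ofReal (k * A) ≠ ∞ := ENNReal.ofReal_ne_top
  refine (ENNReal.add_le_add_iff_right hkA).1 ?_
  have hφ0 : 0 ≤ φ x₀ := by
    rw [← hφ.2.2]
    exact hφ.2.1.monotoneOn Set.self_mem_Ici hx₀pos.le hx₀pos.le
  have hmx : m * x₀ * A = m * b * t := by rw [hx₀]; field_simp
  calc ENNReal.ofReal (A * φ x₀) + ENNReal.ofReal (k * A)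
      = ENNReal.ofReal (m * b * t) := by
        rw [← ENNReal.ofReal_add (by positivity) (by positivity), ← hmx]
        congr 1
        simp only [k]
        ring
    _ = ENNReal.ofReal (m * b) * ENNReal.ofReal t := ENNReal.ofReal_mul' ht.le
    _ = ∫⁻ _ in Set.Ioo 0 t, ENNReal.ofReal (m * b) := by simp
    _ ≤ ∫⁻ s in Set.Ioo 0 t, (oterm φ b (v s) + ENNReal.ofReal k * ENNReal.ofReal (v s)) :=
        lintegral_mono hpt
    _ = (∫⁻ s in Set.Ioo 0 t, oterm φ b (v s)) +
          ENNReal.ofReal k * ∫⁻ s in Set.Ioo 0 t, ENNReal.ofReal (v s) := by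
        rw [lintegral_add_right _ (by fun_prop), lintegral_const_mul _ (by fun_prop)]
    _ ≤ (∫⁻ s in Set.Ioo 0 t, oterm φ b (v s)) + ENNReal.ofReal (k * A) := by
        rw [ENNReal.ofReal_mul hk]
        gcongr

lemma toReal_lintegral_weight_pos {a : ℝ≥0∞} {w : ℝ → ℝ} (hw_pos : ∀ t ∈ Ioa' a, 0 < w t)
    (hw_dec : ∀ s ∈ Ioa' a, ∀ t ∈ Ioa' a, s ≤ t → w t ≤ w s) {t : ℝ} (ht : t ∈ Ioa' a)
    (hWt : ∫⁻ s in Set.Ioo 0 t, ENNReal.ofReal (w s) ≠ ∞) :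
    0 < (∫⁻ s in Set.Ioo 0 t, ENNReal.ofReal (w s)).toReal := by
  refine ENNReal.toReal_pos (ne_of_gt ?_) hWt
  refine lt_of_lt_of_le ?_ (mul_le_lintegral_of_antitone hw_dec ht)
  exact ENNReal.mul_pos (by simpa using hw_pos t ht) (by simpa using ht.1)

/-- The modular `P` of a positive multiple of the characteristic function of `(0,t)`. -/
lemma PmodE_indicator {a : ℝ≥0∞} {φ : ℝ → ℝ} (hφ : IsOrliczFn φ) {w : ℝ → ℝ}
    (hw_meas : Measurable w) (hw_pos : ∀ t ∈ Ioa' a, 0 < w t)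
    (hw_dec : ∀ s ∈ Ioa' a, ∀ t ∈ Ioa' a, s ≤ t → w t ≤ w s) {t : ℝ} (ht : t ∈ Ioa' a)
    (hWt : ∫⁻ s in Set.Ioo 0 t, ENNReal.ofReal (w s) ≠ ∞) {b : ℝ} (hb : 0 < b) :
    PmodE a φ w (Set.indicator (Set.Ioo 0 t) fun _ => ENNReal.ofReal b) =
      ENNReal.ofReal ((∫⁻ s in Set.Ioo 0 t, ENNReal.ofReal (w s)).toReal *
        φ (t * b / (∫⁻ s in Set.Ioo 0 t, ENNReal.ofReal (w s)).toReal)) := by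
  have hApos := toReal_lintegral_weight_pos hw_pos hw_dec ht hWt
  have hsubmaj := submaj_average hw_meas hw_dec ht hWt
  set A := (∫⁻ s in Set.Ioo 0 t, ENNReal.ofReal (w s)).toReal with hA
  have htpos := ht.1
  apply le_antisymm
  · refine (iInf₂_le (Set.indicator (Set.Ioo 0 t) fun _ => A / t)
      ⟨measurable_const.indicator measurableSet_Ioo,
        Set.indicator_nonneg fun _ _ => by positivity, hsubmaj⟩).trans ?_
    calc _ ≤ ∫⁻ s in Ioa' a, (Set.Ioo 0 t).indicator
          (fun _ => ENNReal.ofReal (φ (b / (A / t)) * (A / t))) s := by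
          refine lintegral_mono fun s => ?_
          by_cases hs : s ∈ Set.Ioo 0 t
          · simp [Set.indicator_of_mem hs, otermE, oterm, hApos.ne', htpos.ne', hb.le]
          · simp [Set.indicator_of_notMem hs, otermE, oterm]
      _ ≤ ∫⁻ s, (Set.Ioo 0 t).indicator
          (fun _ => ENNReal.ofReal (φ (b / (A / t)) * (A / t))) s := setLIntegral_le_lintegral _ _
      _ = ENNReal.ofReal (A * φ (t * b / A)) := by
          rw [lintegral_indicator_const measurableSet_Ioo, Real.volume_Ioo,
            ← ENNReal.ofReal_mul' (by linarith)]
          congr 1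
          rw [show b / (A / t) = t * b / A by field_simp]
          field_simp
          ring
  · refine le_iInf₂ fun v hv => ?_
    obtain ⟨hvm, hv0, hvw⟩ := hv
    have hvA : ∫⁻ s in Set.Ioo 0 t, ENNReal.ofReal (v s) ≤ ENNReal.ofReal A := by
      rw [hA, ENNReal.ofReal_toReal hWt]
      calc ∫⁻ s in Set.Ioo 0 t, ENNReal.ofReal (v s)
          ≤ ∫⁻ s in Set.Ioo 0 t, ENNReal.ofReal |v s| := by
            gcongr
            exact le_abs_self _
        _ ≤ ∫⁻ s in Set.Ioo 0 t, decRe a v s := lintegral_le_lintegral_decRe hvm ht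
        _ ≤ ∫⁻ s in Set.Ioo 0 t, decRe a w s := hvw t ht
        _ ≤ _ := setLIntegral_mono' measurableSet_Ioo fun s hs =>
            decRe_le_of_antitone hw_pos hw_dec (Ioo_subset_Ioa' ht hs)
    calc _ ≤ ∫⁻ s in Set.Ioo 0 t, oterm φ b (v s) := jensen_oterm hφ hvm hv0 hb htpos hApos hvA
      _ = ∫⁻ s in Set.Ioo 0 t, otermE φ
            ((Set.Ioo 0 t).indicator (fun _ => ENNReal.ofReal b) s) (v s) := by
          refine setLIntegral_congr_fun measurableSet_Ioo fun s hs => ?_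
          simp [Set.indicator_of_mem hs, otermE, hb.le]
      _ ≤ _ := lintegral_mono_set (Ioo_subset_Ioa' ht)

lemma IsOrliczFn.pos {φ : ℝ → ℝ} (hφ : IsOrliczFn φ) {x : ℝ} (hx : 0 < x) : 0 < φ x := by
  rw [← hφ.2.2]
  exact hφ.2.1 Set.self_mem_Ici hx.le hx

lemma IsOrliczFn.map_mul_le {φ : ℝ → ℝ} (hφ : IsOrliczFn φ) {x y : ℝ} (hx : 0 ≤ x)
    (hx1 : x ≤ 1) (hy : 0 ≤ y) : φ (x * y) ≤ x * φ y := by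
  have := hφ.1.2 (show y ∈ Set.Ici 0 from hy) Set.self_mem_Ici hx (sub_nonneg.2 hx1) (by ring)
  simpa [hφ.2.2] using this

lemma IsOrliczFn.nonempty_le {φ : ℝ → ℝ} (hφ : IsOrliczFn φ) (y : ℝ) :
    {s : ℝ | 0 ≤ s ∧ y ≤ φ s}.Nonempty := by
  have h1 := hφ.pos one_pos
  set N := max 1 (y / φ 1)
  have hN : 1 ≤ N := le_max_left _ _
  have hN0 : 0 < N := by linarith
  refine ⟨N, hN0.le, ?_⟩
  have h := hφ.map_mul_le (inv_nonneg.2 hN0.le) (inv_le_one_of_one_le₀ hN) hN0.le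
  rw [inv_mul_cancel₀ hN0.ne', inv_mul_eq_div, le_div_iff₀ hN0] at h
  have h2 : y / φ 1 ≤ N := le_max_right _ _
  rw [div_le_iff₀ h1] at h2
  linarith

lemma phiInv_pos {φ : ℝ → ℝ} (hφ : IsOrliczFn φ) {y : ℝ} (hy : 0 < y) : 0 < phiInv φ y := by
  have h1 := hφ.pos one_pos
  refine lt_of_lt_of_le (b := min 1 (y / φ 1)) (by positivity) ?_
  refine le_csInf (hφ.nonempty_le y) fun s hs => ?_
  rcases le_total s 1 with h | h
  · refine (min_le_right _ _).trans ?_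
    rw [div_le_iff₀ h1]
    simpa using hs.2.trans (by simpa using hφ.map_mul_le hs.1 h zero_le_one)
  · exact (min_le_left _ _).trans h

lemma le_phiInv {φ : ℝ → ℝ} (hφ : IsOrliczFn φ) {x y : ℝ} (hx : 0 ≤ x) (h : φ x ≤ y) :
    x ≤ phiInv φ y :=
  le_csInf (hφ.nonempty_le y) fun _ hs => (hφ.2.1.le_iff_le hx hs.1).1 (h.trans hs.2)

lemma lt_of_lt_phiInv {φ : ℝ → ℝ} {x y : ℝ} (hx : 0 ≤ x) (h : x < phiInv φ y) : φ x < y := by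
  by_contra! hxy
  exact absurd h (not_lt.2 (csInf_le ⟨0, fun _ hs => hs.1⟩ ⟨hx, hxy⟩))

/-- if `W(t) = ∫₀ᵗ w < ∞` on `I`, then the fundamental function of
`𝓜_{φ,w}` is `F_𝓜(t) = t / (W(t)·φ⁻¹(1/W(t)))`, and moreover
`P((1/c)·χ_(0,t)) = W(t)·φ(t/(c·W(t)))` for every `c > 0`. -/
theorem statement18 (a : ℝ≥0∞) (ha : 0 < a) (φ : ℝ → ℝ) (hφ : IsOrliczFn φ)
    (w : ℝ → ℝ) (hw_meas : Measurable w) (hw_pos : ∀ t ∈ Ioa' a, 0 < w t)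
    (hw_dec : ∀ s ∈ Ioa' a, ∀ t ∈ Ioa' a, s ≤ t → w t ≤ w s)
    (hW : ∀ t ∈ Ioa' a, ∫⁻ s in Set.Ioo 0 t, ENNReal.ofReal (w s) < ∞) :
    (∀ t ∈ Ioa' a,
      Pnorm a φ w (Set.indicator (Set.Ioo 0 t) fun _ => (1:ℝ)) =
        ENNReal.ofReal (t /
          ((∫⁻ s in Set.Ioo 0 t, ENNReal.ofReal (w s)).toReal *
            phiInv φ (1 / (∫⁻ s in Set.Ioo 0 t, ENNReal.ofReal (w s)).toReal)))) ∧
    (∀ t ∈ Ioa' a, ∀ c > (0:ℝ),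
      Pmod a φ w (fun s => (1 / c) * Set.indicator (Set.Ioo 0 t) (fun _ => (1:ℝ)) s) =
        ENNReal.ofReal ((∫⁻ s in Set.Ioo 0 t, ENNReal.ofReal (w s)).toReal *
          φ (t / (c * (∫⁻ s in Set.Ioo 0 t, ENNReal.ofReal (w s)).toReal)))) := by
  refine ⟨fun t ht => ?_, fun t ht c hc => ?_⟩
  · have hWt := (hW t ht).ne
    have hApos := toReal_lintegral_weight_pos hw_pos hw_dec ht hWt
    have key : ∀ ε > (0 : ℝ), PmodE a φ w (fun s => ENNReal.ofReal
        |(Set.Ioo 0 t).indicator (fun _ => (1 : ℝ)) s| / ENNReal.ofReal ε) = _ := fun ε hε => by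
      refine Eq.trans ?_ (PmodE_indicator hφ hw_meas hw_pos hw_dec ht hWt (inv_pos.2 hε))
      congr 1
      ext s
      by_cases hs : s ∈ Set.Ioo 0 t
      · simp [Set.indicator_of_mem hs, ENNReal.ofReal_inv_of_pos hε]
      · simp [Set.indicator_of_notMem hs]
    set A := (∫⁻ s in Set.Ioo 0 t, ENNReal.ofReal (w s)).toReal
    have hu : 0 < phiInv φ (1 / A) := phiInv_pos hφ (by positivity)
    have htpos := ht.1
    set u := phiInv φ (1 / A)
    apply le_antisymm
    · refine ENNReal.le_of_forall_pos_le_add fun δ hδ _ => ?_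
      have hδ' : (0 : ℝ) < δ := hδ
      have hε : 0 < t / (A * u) + δ := by positivity
      have hmem : PmodE a φ w (fun s => ENNReal.ofReal
          |(Set.Ioo 0 t).indicator (fun _ => (1 : ℝ)) s| /
            ENNReal.ofReal (t / (A * u) + δ)) ≤ 1 := by
        rw [key _ hε, ← ENNReal.ofReal_one]
        refine ENNReal.ofReal_le_ofReal ?_
        have hlt : t * (t / (A * u) + δ)⁻¹ / A < u := by
          rw [div_lt_iff₀ hApos, ← div_eq_mul_inv, div_lt_iff₀ hε]
          have : u * A * (t / (A * u) + δ) = t + u * A * δ := by field_simp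
          rw [this]
          have : 0 < u * A * δ := by positivity
          linarith
        have := lt_of_lt_phiInv (by positivity) hlt
        rw [lt_div_iff₀ hApos] at this
        linarith
      refine (iInf₂_le _ ⟨hε, hmem⟩).trans ?_
      rw [ENNReal.ofReal_add (by positivity) hδ'.le, ENNReal.ofReal_coe_nnreal]
    · refine le_iInf₂ fun ε hε => ENNReal.ofReal_le_ofReal ?_
      obtain ⟨hε, h⟩ := hε
      rw [key ε hε, ← ENNReal.ofReal_one, ENNReal.ofReal_le_ofReal_iff zero_le_one] at h
      have hle : t * ε⁻¹ / A ≤ u := le_phiInv hφ (by positivity) (by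
        rw [le_div_iff₀ hApos]
        linarith)
      rw [div_le_iff₀ hApos, ← div_eq_mul_inv, div_le_iff₀ hε] at hle
      rw [div_le_iff₀ (by positivity)]
      linarith
  · have h := PmodE_indicator hφ hw_meas hw_pos hw_dec ht (hW t ht).ne (inv_pos.2 hc)
    rw [← div_eq_mul_inv, div_div] at h
    rw [← h, Pmod]
    congr 1
    ext s
    by_cases hs : s ∈ Set.Ioo 0 t
    · simp [Set.indicator_of_mem hs, abs_of_pos hc]
    · simp [Set.indicator_of_notMem hs]

end OrliczRearrangement

end
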